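/- arXiv:math/9904030 — 3 statements merged into one kernel-verified Lean document; each statement's English description precedes it below -/
import Mathlib

section
/- Set Γ• = {Σ_{i=2}^l k_i·β_i : k_i ∈ {0,1}}. For every integer r with 0 ≤ r ≤ 2l−1 there exists a unique γ_r ∈ Γ• such that the W-stabilizer of ρ − r·β_1 + γ_r is trivial. Moreover, for this γ_r there exists w_r ∈ W with ρ − r·β_1 + γ_r = w_r·ρ and sgn(w_r) = (−1)^r. -/
open scoped BigOperators

noncomputable section

/-- The linear automorphism of `Fin l → ℚ` permuting the coordinates via `σ`. -/
def permEquiv (l : ℕ) (σ : Equiv.Perm (Fin l)) : (Fin l → ℚ) ≃ₗ[ℚ] (Fin l → ℚ) :=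
  LinearEquiv.funCongrLeft ℚ ℚ σ

/-- The linear map changing the sign of the `i`-th coordinate. -/
def signChangeMap (l : ℕ) (i : Fin l) : (Fin l → ℚ) →ₗ[ℚ] (Fin l → ℚ) where
  toFun v := fun j => if j = i then -v j else v j
  map_add' := by intro u v; funext j; by_cases h : j = i <;> simp [h] <;> ring
  map_smul' := by intro c v; funext j; by_cases h : j = i <;> simp [h] <;> ring

/-- The linear automorphism changing the sign of the `i`-th coordinate. -/
def signChange (l : ℕ) (i : Fin l) : (Fin l → ℚ) ≃ₗ[ℚ] (Fin l → ℚ) :=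
  LinearEquiv.ofLinear (signChangeMap l i) (signChangeMap l i)
    (by apply LinearMap.ext; intro v; funext j;
        by_cases h : j = i <;> simp [signChangeMap, h])
    (by apply LinearMap.ext; intro v; funext j;
        by_cases h : j = i <;> simp [signChangeMap, h])

/-- The group `W` of signed permutations of the coordinates, as a subgroup of
`GL(Fin l → ℚ)`: the subgroup generated by the coordinate permutations and the
sign changes of individual coordinates. -/
def signedPermGroup (l : ℕ) : Subgroup ((Fin l → ℚ) ≃ₗ[ℚ] (Fin l → ℚ)) :=
  Subgroup.closure (Set.range (permEquiv l) ∪ Set.range (signChange l))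

/-- The Weyl vector `ρ = Σ_{i=1}^l (l − i + 1/2)·β_i` of `osp(1,2l)`;
in coordinates, `ρ_j = l − j − 1/2` for the `0`-indexed coordinate `j`. -/
def rho (l : ℕ) : Fin l → ℚ := fun j => (l : ℚ) - (j : ℚ) - 1/2

/-- The standard basis vector `β_i` of `ℚ^l`, with `1`-indexed index `i`. -/
def betaN (l : ℕ) (i : ℕ) : Fin l → ℚ := fun j => if (j : ℕ) + 1 = i then 1 else 0
/-- The sign of a signed permutation: its determinant, which is `±1`,
recorded as an integer. -/
def sgn (l : ℕ) (w : (Fin l → ℚ) ≃ₗ[ℚ] (Fin l → ℚ)) : ℤ :=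
  if LinearMap.det w.toLinearMap = 1 then 1 else -1

/-- The basis element `e^λ` of the group algebra
`R = MonoidAlgebra ℤ (Multiplicative (Fin l → ℚ))`. -/
def expw (l : ℕ) (lam : Fin l → ℚ) : MonoidAlgebra ℤ (Multiplicative (Fin l → ℚ)) :=
  MonoidAlgebra.of ℤ (Multiplicative (Fin l → ℚ)) (Multiplicative.ofAdd lam)

/-- The action of a linear automorphism `w` of `Fin l → ℚ` on the group algebra
`R`, sending `e^λ` to `e^{wλ}`. -/
def act (l : ℕ) (w : (Fin l → ℚ) ≃ₗ[ℚ] (Fin l → ℚ)) :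
    MonoidAlgebra ℤ (Multiplicative (Fin l → ℚ)) ≃ₐ[ℤ]
      MonoidAlgebra ℤ (Multiplicative (Fin l → ℚ)) :=
  MonoidAlgebra.domCongr ℤ ℤ (AddEquiv.toMultiplicative w.toAddEquiv)
/-- The set `Γ• = {Σ_{i=2}^l k_i·β_i : k_i ∈ {0,1}}`. -/
def GammaSet (l : ℕ) : Set (Fin l → ℚ) :=
  {γ | ∃ k : ℕ → ℚ, (∀ i, k i = 0 ∨ k i = 1) ∧
    γ = ∑ i ∈ Finset.Icc 2 l, k i • betaN l i}

@[simp]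
theorem permEquiv_apply (l : ℕ) (σ : Equiv.Perm (Fin l)) (v : Fin l → ℚ) (j : Fin l) :
    permEquiv l σ v j = v (σ j) := rfl

@[simp]
theorem signChange_apply (l : ℕ) (i : Fin l) (v : Fin l → ℚ) (j : Fin l) :
    signChange l i v j = if j = i then -v j else v j := rfl

theorem permEquiv_mem (l : ℕ) (σ : Equiv.Perm (Fin l)) : permEquiv l σ ∈ signedPermGroup l :=
  Subgroup.subset_closure (Or.inl ⟨σ, rfl⟩)

theorem signChange_mem (l : ℕ) (i : Fin l) : signChange l i ∈ signedPermGroup l :=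
  Subgroup.subset_closure (Or.inr ⟨i, rfl⟩)

theorem det_permEquiv (l : ℕ) (σ : Equiv.Perm (Fin l)) :
    LinearMap.det (permEquiv l σ).toLinearMap = ((Equiv.Perm.sign σ : ℤ) : ℚ) := by
  have h : (permEquiv l σ).toLinearMap = Matrix.toLin' (σ.permMatrix ℚ) := by
    apply LinearMap.ext
    intro v
    rw [Matrix.toLin'_apply, Matrix.permMatrix_mulVec]
    rfl
  rw [h, LinearMap.det_toLin', Matrix.det_permutation]

theorem det_signChange (l : ℕ) (i : Fin l) :
    LinearMap.det (signChange l i).toLinearMap = -1 := by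
  have h : (signChange l i).toLinearMap =
      Matrix.toLin' (Matrix.diagonal fun j => if j = i then (-1 : ℚ) else 1) := by
    apply LinearMap.ext
    intro v
    funext j
    rw [Matrix.toLin'_apply, Matrix.mulVec_diagonal]
    by_cases hj : j = i <;> simp [hj]
  rw [h, LinearMap.det_toLin', Matrix.det_diagonal]
  simp

theorem sgn_eq_of_det_eq {l : ℕ} {w : (Fin l → ℚ) ≃ₗ[ℚ] (Fin l → ℚ)} {r : ℕ}
    (h : LinearMap.det w.toLinearMap = (-1) ^ r) : sgn l w = (-1) ^ r := by
  unfold sgn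
  rw [h]
  rcases neg_one_pow_eq_or ℤ r with hr | hr
  · have hq : (-1 : ℚ) ^ r = 1 := by exact_mod_cast congrArg (Int.cast : ℤ → ℚ) hr
    rw [hr, hq, if_pos rfl]
  · have hq : (-1 : ℚ) ^ r = -1 := by exact_mod_cast congrArg (Int.cast : ℤ → ℚ) hr
    rw [hr, hq, if_neg (by norm_num)]

/-- The elements of `signedPermGroup l` are signed permutations of the coordinates. -/
theorem exists_perm_sign_of_mem {l : ℕ} {w : (Fin l → ℚ) ≃ₗ[ℚ] (Fin l → ℚ)}
    (hw : w ∈ signedPermGroup l) :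
    ∃ (σ : Equiv.Perm (Fin l)) (ε : Fin l → ℚ), (∀ j, |ε j| = 1) ∧
      ∀ v j, w v j = ε j * v (σ j) := by
  induction hw using Subgroup.closure_induction with
  | mem w h =>
    rcases h with ⟨σ, rfl⟩ | ⟨i, rfl⟩
    · exact ⟨σ, fun _ => 1, by simp, by simp⟩
    · refine ⟨1, fun j => if j = i then -1 else 1, fun j => ?_, fun v j => ?_⟩ <;>
        by_cases h : j = i <;> simp [h]
  | one => exact ⟨1, fun _ => 1, by simp, by simp⟩
  | mul u w _ _ hu hw =>
    obtain ⟨σ, ε, hε, h⟩ := hu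
    obtain ⟨τ, δ, hδ, h'⟩ := hw
    refine ⟨τ * σ, fun j => ε j * δ (σ j), fun j => ?_, fun v j => ?_⟩
    · rw [abs_mul, hε, hδ, one_mul]
    · rw [LinearEquiv.mul_apply, h, h', mul_assoc, Equiv.Perm.mul_apply]
  | inv w _ hw =>
    obtain ⟨σ, ε, hε, h⟩ := hw
    refine ⟨σ⁻¹, fun j => ε (σ⁻¹ j), fun j => hε _, fun v j => ?_⟩
    have hv : w (w⁻¹ v) = v := by rw [← LinearEquiv.mul_apply, mul_inv_cancel]; rfl
    have key : v (σ⁻¹ j) = ε (σ⁻¹ j) * (w⁻¹ v) j := by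
      conv_lhs => rw [← hv, h]
      simp
    have hsq : ε (σ⁻¹ j) * ε (σ⁻¹ j) = 1 := by
      rw [← abs_mul_abs_self, hε, one_mul]
    rw [key, ← mul_assoc, hsq, one_mul]

/-- A vector whose coordinates are nonzero with distinct absolute values has trivial
stabilizer. -/
theorem eq_one_of_apply_eq_self {l : ℕ} {x : Fin l → ℚ} (hx : ∀ j, x j ≠ 0)
    (hinj : Function.Injective fun j => |x j|) {w : (Fin l → ℚ) ≃ₗ[ℚ] (Fin l → ℚ)}
    (hw : w ∈ signedPermGroup l) (hwx : w x = x) : w = 1 := by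
  obtain ⟨σ, ε, hε, h⟩ := exists_perm_sign_of_mem hw
  have hσ : ∀ j, σ j = j := fun j => hinj <| by
    have := congrArg abs (h x j)
    rw [hwx, abs_mul, hε, one_mul] at this
    exact this.symm
  have hε1 : ∀ j, ε j = 1 := fun j => by
    have := h x j
    rw [hwx, hσ] at this
    exact mul_right_cancel₀ (hx j) (by rw [← this, one_mul])
  refine LinearEquiv.ext fun v => funext fun j => ?_
  rw [h, hσ, hε1, one_mul]
  rfl

/-- A vector with trivial stabilizer has coordinates with distinct absolute values. -/
theorem abs_injective_of_stabilizer_trivial {l : ℕ} {x : Fin l → ℚ}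
    (h : ∀ w ∈ signedPermGroup l, w x = x → w = 1) :
    Function.Injective fun j => |x j| := by
  intro i j hij
  by_contra hne
  rcases abs_eq_abs.mp hij with hij | hij
  · have := h (permEquiv l (Equiv.swap i j)) (permEquiv_mem _ _) (funext fun a => by
      rw [permEquiv_apply, Equiv.swap_apply_def]
      split_ifs with h1 h2
      · rw [h1, hij]
      · rw [h2, hij]
      · rfl)
    have := congrFun (LinearEquiv.congr_fun this (Pi.single i 1)) i
    simp [Ne.symm hne] at this
  · have := h (signChange l i * (signChange l j * permEquiv l (Equiv.swap i j)))
      (mul_mem (signChange_mem _ _) (mul_mem (signChange_mem _ _) (permEquiv_mem _ _)))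
      (funext fun a => by
        simp only [LinearEquiv.mul_apply, signChange_apply, permEquiv_apply,
          Equiv.swap_apply_def]
        split_ifs with h1 h2 h2
        · exact absurd (h1.symm.trans h2) hne
        · rw [h1, hij]
        · rw [h2, hij, neg_neg]
        · rfl)
    have := congrFun (LinearEquiv.congr_fun this (Pi.single i 1)) i
    simp [Ne.symm hne, hne, LinearEquiv.mul_apply] at this

theorem sum_smul_betaN_apply (l : ℕ) (k : ℕ → ℚ) (j : Fin l) :
    (∑ i ∈ Finset.Icc 2 l, k i • betaN l i) j = if (j : ℕ) = 0 then 0 else k (j + 1) := by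
  have := j.2
  simp only [Finset.sum_apply, Pi.smul_apply, betaN, smul_eq_mul, mul_ite, mul_one, mul_zero,
    Finset.sum_ite_eq, Finset.mem_Icc]
  by_cases hj : (j : ℕ) = 0
  · simp [hj]
  · rw [if_pos (by omega), if_neg hj]

theorem mem_GammaSet_iff {l : ℕ} {γ : Fin l → ℚ} :
    γ ∈ GammaSet l ↔ (∀ j, γ j = 0 ∨ γ j = 1) ∧ ∀ j : Fin l, (j : ℕ) = 0 → γ j = 0 := by
  constructor
  · rintro ⟨k, hk, rfl⟩
    simp only [sum_smul_betaN_apply]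
    refine ⟨fun j => ?_, fun j hj => if_pos hj⟩
    split_ifs
    · exact Or.inl rfl
    · exact hk _
  · rintro ⟨h1, h0⟩
    refine ⟨fun i => if h : i - 1 < l then γ ⟨i - 1, h⟩ else 0, fun i => ?_, funext fun j => ?_⟩
    · dsimp only
      split_ifs
      · exact h1 _
      · exact Or.inl rfl
    · rw [sum_smul_betaN_apply]
      by_cases hj : (j : ℕ) = 0
      · rw [if_pos hj, h0 j hj]
      · simp [hj]

theorem rho_pos (l : ℕ) (j : Fin l) : 0 < rho l j := by
  have : ((j : ℕ) : ℚ) + 1 ≤ l := by exact_mod_cast j.2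
  unfold rho
  linarith

theorem rho_injective (l : ℕ) : Function.Injective (rho l) := by
  intro i j h
  have : ((i : ℕ) : ℚ) = (j : ℕ) := by
    unfold rho at h
    linarith
  exact Fin.ext (by exact_mod_cast this)

/-- If `|x 0| = ρ m` and the other coordinates of `x` are those of `ρ` shifted by
`γ j ∈ {0, 1}`, then distinctness of the absolute values of the coordinates forces `γ` to be
the indicator function of `{1, …, m}`. -/
theorem eq_indicator_of_abs_injective {l m : ℕ} (hm : m < l) {x γ : Fin l → ℚ}
    (hγ : ∀ j, γ j = 0 ∨ γ j = 1)
    (hx0 : ∀ j : Fin l, (j : ℕ) = 0 → |x j| = rho l ⟨m, hm⟩)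
    (hx : ∀ j : Fin l, (j : ℕ) ≠ 0 → x j = rho l j + γ j)
    (hinj : Function.Injective fun j => |x j|) (j : Fin l) (hj : (j : ℕ) ≠ 0) :
    γ j = if (j : ℕ) ≤ m then 1 else 0 := by
  have habs : ∀ j : Fin l, (j : ℕ) ≠ 0 → |x j| = rho l j + γ j := fun j hj => by
    rw [hx j hj, abs_of_pos]
    rcases hγ j with h | h <;> linarith [rho_pos l j]
  have hne : ∀ i j : Fin l, (i : ℕ) < j → |x i| ≠ |x j| := fun i j hij h =>
    absurd (congrArg Fin.val (hinj h)) hij.ne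
  have hm0 : ∀ h : m ≠ 0, γ ⟨m, hm⟩ = 1 := fun h => by
    refine (hγ _).resolve_left fun h0 => hne ⟨0, by omega⟩ ⟨m, hm⟩ (Nat.pos_of_ne_zero h) ?_
    rw [hx0 _ rfl, habs _ h, h0, add_zero]
  have hm1 : ∀ h : m + 1 < l, γ ⟨m + 1, h⟩ = 0 := fun h => by
    refine (hγ _).resolve_right fun h1 => hne ⟨0, by omega⟩ ⟨m + 1, h⟩ (Nat.succ_pos m) ?_
    rw [hx0 _ rfl, habs _ (Nat.succ_ne_zero m), h1]
    simp only [rho]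
    push_cast
    ring
  have hstep : ∀ a : ℕ, a ≠ 0 → ∀ h : a + 1 < l,
      ¬ (γ ⟨a, by omega⟩ = 0 ∧ γ ⟨a + 1, h⟩ = 1) := fun a ha h ⟨h0, h1⟩ => by
    refine hne ⟨a, by omega⟩ ⟨a + 1, h⟩ (Nat.lt_succ_self a) ?_
    rw [habs _ ha, habs _ (Nat.succ_ne_zero a), h0, h1]
    simp only [rho]
    push_cast
    ring
  have hdown : ∀ d a : ℕ, a ≠ 0 → ∀ h : a + d = m, γ ⟨a, by omega⟩ = 1 := by
    intro d
    induction d with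
    | zero =>
      intro a ha h
      obtain rfl : a = m := h
      exact hm0 ha
    | succ d ih =>
      intro a ha h
      exact (hγ _).resolve_left fun h0 =>
        hstep a ha (by omega) ⟨h0, ih (a + 1) (by omega) (by omega)⟩
  have hup : ∀ d : ℕ, ∀ h : m + 1 + d < l, γ ⟨m + 1 + d, h⟩ = 0 := by
    intro d
    induction d with
    | zero => exact hm1
    | succ d ih =>
      intro h
      exact (hγ _).resolve_right fun h1 =>
        hstep (m + 1 + d) (by omega) h ⟨ih (by omega), h1⟩
  split_ifs with hjm
  · exact hdown (m - j) j hj (by omega)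
  · obtain ⟨d, hd⟩ := Nat.exists_eq_add_of_lt (not_le.mp hjm)
    have hd' : (j : ℕ) = m + 1 + d := by omega
    have : j = ⟨m + 1 + d, hd' ▸ j.2⟩ := Fin.ext hd'
    rw [this]
    exact hup d _

theorem rho_cycleRange_symm {n : ℕ} (m j : Fin (n + 1)) (hj : j ≠ 0) :
    rho (n + 1) (m.cycleRange.symm j) = rho (n + 1) j + if (j : ℕ) ≤ m then 1 else 0 := by
  obtain ⟨i, rfl⟩ := Fin.exists_succ_eq.mpr hj
  rw [Fin.cycleRange_symm_succ]
  by_cases h : i.castSucc < m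
  · have h' : (i : ℕ) + 1 ≤ m := h
    rw [Fin.succAbove_of_castSucc_lt _ _ h]
    simp [rho, h']
    ring
  · have h' : ¬ (i : ℕ) + 1 ≤ m := h
    rw [Fin.succAbove_of_le_castSucc _ _ (not_lt.mp h)]
    simp [rho, h']

/-- For `r ≤ 2n + 1` there is a signed permutation `w` of sign `(-1) ^ r` which permutes the
coordinates of `ρ` by an inverse cycle `m.cycleRange.symm`, up to the sign of the first one, such
that `w ρ` and `ρ - r β₁` have the same first coordinate. -/
theorem exists_signedPerm_rho {n r : ℕ} (hr : r ≤ 2 * n + 1) :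
    ∃ (m : Fin (n + 1)), ∃ w ∈ signedPermGroup (n + 1),
      (∀ j, |w (rho (n + 1)) j| = rho (n + 1) (m.cycleRange.symm j)) ∧
      w (rho (n + 1)) 0 = rho (n + 1) 0 - r ∧
      (∀ j ≠ 0, w (rho (n + 1)) j = rho (n + 1) (m.cycleRange.symm j)) ∧
      sgn (n + 1) w = (-1) ^ r := by
  have hsign (m : Fin (n + 1)) : LinearMap.det (permEquiv (n + 1) m.cycleRange.symm).toLinearMap
      = (-1) ^ (m : ℕ) := by
    rw [det_permEquiv, Equiv.Perm.sign_symm, Fin.sign_cycleRange]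
    simp
  by_cases h : r ≤ n
  · refine ⟨⟨r, by omega⟩, permEquiv _ (Fin.cycleRange ⟨r, by omega⟩).symm, permEquiv_mem _ _,
      fun j => ?_, ?_, fun j _ => rfl, sgn_eq_of_det_eq (hsign _)⟩
    · rw [permEquiv_apply, abs_of_pos (rho_pos _ _)]
    · rw [permEquiv_apply, Fin.cycleRange_symm_zero]
      simp [rho]
      ring
  · obtain ⟨m, hm⟩ := Nat.exists_eq_add_of_le hr
    refine ⟨⟨m, by omega⟩, signChange _ 0 * permEquiv _ (Fin.cycleRange ⟨m, by omega⟩).symm,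
      mul_mem (signChange_mem _ _) (permEquiv_mem _ _), fun j => ?_, ?_, fun j hj => ?_,
      sgn_eq_of_det_eq ?_⟩
    · rw [LinearEquiv.mul_apply, signChange_apply, permEquiv_apply]
      split_ifs
      · rw [abs_neg, abs_of_pos (rho_pos _ _)]
      · rw [abs_of_pos (rho_pos _ _)]
    · have hq : (2 * n + 1 : ℚ) = r + m := by exact_mod_cast hm
      rw [LinearEquiv.mul_apply, signChange_apply, permEquiv_apply, Fin.cycleRange_symm_zero,
        if_pos rfl]
      simp [rho]
      linarith
    · rw [LinearEquiv.mul_apply, signChange_apply, permEquiv_apply, if_neg hj]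
    · have : (signChange (n + 1) 0 * permEquiv _ (Fin.cycleRange ⟨m, by omega⟩).symm).toLinearMap
          = (signChange (n + 1) 0).toLinearMap *
            (permEquiv _ (Fin.cycleRange ⟨m, by omega⟩).symm).toLinearMap := rfl
      rw [this, map_mul, hsign, det_signChange]
      have hp : (-1 : ℚ) ^ r * (-1) ^ m = -1 := by
        rw [← pow_add, ← hm, pow_succ, pow_mul]
        simp
      have hsq : (-1 : ℚ) ^ m * (-1) ^ m = 1 := by
        rw [← mul_pow]
        simp
      linear_combination (-(-1) ^ m) * hp + (-1) ^ r * hsq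

/-- For every `0 ≤ r ≤ 2l−1` there is a unique `γ_r ∈ Γ•` such that the `W`-stabilizer
of `ρ − r·β_1 + γ_r` is trivial; moreover `ρ − r·β_1 + γ_r = w_r·ρ` for some `w_r ∈ W`
with `sgn(w_r) = (−1)^r`. -/
theorem stmt_2 (l : ℕ) (hl : 1 ≤ l) (r : ℕ) (hr : r ≤ 2 * l - 1) :
    ∃ γ : Fin l → ℚ,
      (γ ∈ GammaSet l ∧
        ∀ w ∈ signedPermGroup l,
          w (rho l - (r : ℚ) • betaN l 1 + γ) = rho l - (r : ℚ) • betaN l 1 + γ → w = 1) ∧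
      (∀ γ' : Fin l → ℚ,
        (γ' ∈ GammaSet l ∧
          ∀ w ∈ signedPermGroup l,
            w (rho l - (r : ℚ) • betaN l 1 + γ') = rho l - (r : ℚ) • betaN l 1 + γ' → w = 1) →
        γ' = γ) ∧
      ∃ w ∈ signedPermGroup l,
        rho l - (r : ℚ) • betaN l 1 + γ = w (rho l) ∧ sgn l w = (-1) ^ r := by
  obtain ⟨n, rfl⟩ : ∃ n, l = n + 1 := ⟨l - 1, by omega⟩
  obtain ⟨m, w, hw, habs, hw0, hwj, hsgn⟩ := exists_signedPerm_rho (n := n) (r := r) (by omega)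
  have hcoord : ∀ (γ : Fin (n + 1) → ℚ), γ ∈ GammaSet (n + 1) →
      (rho (n + 1) - (r : ℚ) • betaN (n + 1) 1 + γ) 0 = rho (n + 1) 0 - r ∧
      ∀ j : Fin (n + 1), (j : ℕ) ≠ 0 →
        (rho (n + 1) - (r : ℚ) • betaN (n + 1) 1 + γ) j = rho (n + 1) j + γ j := by
    intro γ hγ
    refine ⟨?_, fun j hj => ?_⟩
    · have : γ 0 = 0 := (mem_GammaSet_iff.mp hγ).2 0 rfl
      simp [betaN, this]
    · have : j ≠ 0 := fun h => hj (by simp [h])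
      simp [betaN, this]
  let γ : Fin (n + 1) → ℚ := fun j => if (j : ℕ) = 0 then 0 else if (j : ℕ) ≤ m then 1 else 0
  have hγ : γ ∈ GammaSet (n + 1) := by
    refine mem_GammaSet_iff.mpr ⟨fun j => ?_, fun j hj => if_pos hj⟩
    dsimp only [γ]
    split_ifs <;> simp
  have hmain : rho (n + 1) - (r : ℚ) • betaN (n + 1) 1 + γ = w (rho (n + 1)) := by
    funext j
    by_cases hj : j = 0
    · rw [hj, (hcoord γ hγ).1, hw0]
    · have hj' : (j : ℕ) ≠ 0 := fun h => hj (Fin.ext h)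
      rw [(hcoord γ hγ).2 j hj', hwj j hj, rho_cycleRange_symm m j hj]
      simp only [γ, if_neg hj']
  refine ⟨γ, ⟨hγ, fun u hu hux => ?_⟩, fun γ' ⟨hγ', hstab⟩ => ?_, w, hw, hmain, hsgn⟩
  · rw [hmain] at hux
    refine eq_one_of_apply_eq_self (fun j => ?_) (fun i j hij => ?_) hu hux
    · rw [← abs_pos, habs]
      exact rho_pos _ _
    · simp only [habs] at hij
      exact m.cycleRange.symm.injective (rho_injective _ hij)
  · funext j
    by_cases hj : (j : ℕ) = 0
    · rw [(mem_GammaSet_iff.mp hγ').2 j hj, (mem_GammaSet_iff.mp hγ).2 j hj]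
    · rw [eq_indicator_of_abs_injective m.2 (mem_GammaSet_iff.mp hγ').1 (fun i hi => ?_)
        (hcoord γ' hγ').2 (abs_injective_of_stabilizer_trivial hstab) j hj]
      · simp only [γ, if_neg hj]
      · obtain rfl : i = 0 := Fin.ext hi
        rw [(hcoord γ' hγ').1, ← hw0, habs, Fin.cycleRange_symm_zero]
end
end

section
/- Let s_i ∈ W (1 ≤ i ≤ l−1) be the transposition of the i-th and (i+1)-th coordinates and s_l ∈ W the sign change of the l-th coordinate. Then: (a) for 1 ≤ r ≤ l−1 one has ρ − r·β_1 + Σ_{i=2}^{r+1} β_i = (s_1 s_2 ⋯ s_r)·ρ; (b) for l ≤ r ≤ 2l−1 one has ρ − r·β_1 + Σ_{i=2}^{2l−r} β_i = (s_1 ⋯ s_{l-1} s_l s_{l−1} ⋯ s_{2l−r})·ρ, where for r = l the trailing descending product s_{l−1} ⋯ s_{2l−r} is empty (and the sums Σ over an empty index range are 0). -/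
open scoped BigOperators

noncomputable section

/-- The generator `s_i` of `W` (for `1 ≤ i ≤ l`, `1`-indexed): for `1 ≤ i ≤ l−1` it is
the transposition of the `i`-th and `(i+1)`-th coordinates, and `s_l` is the sign change
of the `l`-th coordinate. -/
def sGen (l : ℕ) (i : ℕ) : (Fin l → ℚ) ≃ₗ[ℚ] (Fin l → ℚ) :=
  if h : 1 ≤ i ∧ i < l then
    permEquiv l (Equiv.swap ⟨i - 1, by omega⟩ ⟨i, h.2⟩)
  else if h' : i = l ∧ 0 < l then signChange l ⟨l - 1, by omega⟩
  else 1

theorem sGen_apply_transposition {l i : ℕ} (hi : 1 ≤ i) (hil : i < l) (f : ℕ → ℚ) :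
    sGen l i (fun j : Fin l => f j) =
      fun j : Fin l => if (j : ℕ) + 1 = i then f i else if (j : ℕ) = i then f (i - 1) else f j := by
  funext j
  have h : 1 ≤ i ∧ i < l := ⟨hi, hil⟩
  simp only [sGen, h, and_self, dite_true, permEquiv, LinearEquiv.funCongrLeft_apply,
    LinearMap.funLeft_apply, Equiv.swap_apply_def, Fin.ext_iff]
  split_ifs <;> first | rfl | omega

theorem sGen_apply_signChange {l : ℕ} (hl : 1 ≤ l) (f : ℕ → ℚ) :
    sGen l l (fun j : Fin l => f j) = fun j : Fin l => if (j : ℕ) + 1 = l then -f j else f j := by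
  funext j
  have h : (j : ℕ) + 1 = l ↔ (j : ℕ) = l - 1 := by omega
  have hl' : 0 < l := hl
  simp [sGen, hl', signChange, signChangeMap, Fin.ext_iff, h]

theorem prod_sGen_ascending_apply {l n : ℕ} (hn : n < l) (f : ℕ → ℚ) :
    ((List.range n).map (fun k => sGen l (k + 1))).prod (fun j : Fin l => f j) =
      fun j : Fin l => if (j : ℕ) = 0 then f n else if (j : ℕ) ≤ n then f (j - 1) else f j := by
  induction n generalizing f with
  | zero =>
    funext j
    by_cases h : (j : ℕ) = 0 <;> simp [h]
  | succ n ih =>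
    rw [List.range_succ, List.map_append, List.prod_append, LinearEquiv.mul_apply]
    simp only [List.map_cons, List.map_nil, List.prod_singleton]
    rw [sGen_apply_transposition (by omega) hn,
      ih (by omega) (fun j => if j + 1 = n + 1 then f (n + 1) else
        if j = n + 1 then f (n + 1 - 1) else f j)]
    funext j
    grind

theorem prod_sGen_descending_apply {l m : ℕ} (hm : m < l) (f : ℕ → ℚ) :
    ((List.range m).map (fun k => sGen l (l - 1 - k))).prod (fun j : Fin l => f j) =
      fun j : Fin l => if (j : ℕ) + 1 = l then f (l - 1 - m)
        else if l - 1 - m ≤ (j : ℕ) then f (j + 1) else f j := by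
  induction m generalizing f with
  | zero =>
    funext j
    simp only [List.range_zero, List.map_nil, List.prod_nil, LinearEquiv.coe_one, id_eq]
    grind
  | succ m ih =>
    rw [List.range_succ, List.map_append, List.prod_append, LinearEquiv.mul_apply]
    simp only [List.map_cons, List.map_nil, List.prod_singleton]
    rw [sGen_apply_transposition (by omega) (by omega),
      ih (by omega) (fun j => if j + 1 = l - 1 - m then f (l - 1 - m) else
        if j = l - 1 - m then f (l - 1 - m - 1) else f j)]
    funext j
    grind

theorem prod_sGen_ascending_descending_apply {n m : ℕ} (hm : m ≤ n) (f : ℕ → ℚ) :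
    (((List.range (n + 1)).map (fun k => sGen (n + 1) (k + 1))) ++
      ((List.range m).map (fun k => sGen (n + 1) (n + 1 - 1 - k)))).prod
        (fun j : Fin (n + 1) => f j) =
      fun j : Fin (n + 1) =>
        if (j : ℕ) = 0 then -f (n - m) else if (j : ℕ) ≤ n - m then f (j - 1) else f j := by
  let g : ℕ → ℚ := fun j =>
    if j + 1 = n + 1 then f (n + 1 - 1 - m) else if n + 1 - 1 - m ≤ j then f (j + 1) else f j
  rw [List.prod_append, LinearEquiv.mul_apply, prod_sGen_descending_apply (by omega),
    List.range_succ, List.map_append, List.prod_append, LinearEquiv.mul_apply]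
  simp only [List.map_cons, List.map_nil, List.prod_singleton]
  rw [sGen_apply_signChange (by omega) g,
    prod_sGen_ascending_apply (by omega) (fun j => if j + 1 = n + 1 then -g j else g j)]
  funext j
  grind

theorem rho_sub_smul_add_sum_apply (l r n : ℕ) (j : Fin l) :
    (rho l - (r : ℚ) • betaN l 1 + ∑ i ∈ Finset.Icc 2 n, betaN l i) j =
      (l : ℚ) - j - 1 / 2 - (if (j : ℕ) = 0 then (r : ℚ) else 0) +
        if 1 ≤ (j : ℕ) ∧ (j : ℕ) + 1 ≤ n then 1 else 0 := by
  simp [rho, betaN, Finset.sum_apply]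

/-- (a) For `1 ≤ r ≤ l−1`, `ρ − r·β_1 + Σ_{i=2}^{r+1} β_i = (s_1 s_2 ⋯ s_r)·ρ`;
(b) for `l ≤ r ≤ 2l−1`,
`ρ − r·β_1 + Σ_{i=2}^{2l−r} β_i = (s_1 ⋯ s_{l−1} s_l s_{l−1} ⋯ s_{2l−r})·ρ`. -/
theorem stmt_3 (l : ℕ) (hl : 1 ≤ l) :
    (∀ r : ℕ, 1 ≤ r → r ≤ l - 1 →
      rho l - (r : ℚ) • betaN l 1 + ∑ i ∈ Finset.Icc 2 (r + 1), betaN l i =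
        (((List.range r).map (fun k => sGen l (k + 1))).prod : _) (rho l)) ∧
    (∀ r : ℕ, l ≤ r → r ≤ 2 * l - 1 →
      rho l - (r : ℚ) • betaN l 1 + ∑ i ∈ Finset.Icc 2 (2 * l - r), betaN l i =
        ((((List.range l).map (fun k => sGen l (k + 1))) ++
          ((List.range (r - l)).map (fun k => sGen l (l - 1 - k)))).prod : _) (rho l)) := by
  have hrho : rho l = fun j : Fin l => (fun k : ℕ => (l : ℚ) - k - 1 / 2) j := rfl
  refine ⟨fun r hr hrl => ?_, fun r hlr hr => ?_⟩
  · funext j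
    rw [rho_sub_smul_add_sum_apply, hrho,
      prod_sGen_ascending_apply (by omega) (fun k => (l : ℚ) - k - 1 / 2)]
    rcases Nat.eq_zero_or_pos (j : ℕ) with h | h
    · simp only [h]
      norm_num
      ring
    · have h0 : (j : ℕ) ≠ 0 := by omega
      by_cases h1 : (j : ℕ) ≤ r
      · simp [h0, h1, Nat.cast_sub (R := ℚ) (show 1 ≤ (j : ℕ) from h), Nat.one_le_iff_ne_zero]
        ring
      · simp [h0, h1]
  · obtain ⟨n, rfl⟩ : ∃ n, l = n + 1 := ⟨l - 1, by omega⟩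
    obtain ⟨m, rfl⟩ : ∃ m, r = n + 1 + m := ⟨r - (n + 1), by omega⟩
    have hm : m ≤ n := by omega
    have hsub : n + 1 + m - (n + 1) = m := by omega
    funext j
    rw [rho_sub_smul_add_sum_apply, hrho, hsub,
      prod_sGen_ascending_descending_apply hm (fun k => ((n + 1 : ℕ) : ℚ) - k - 1 / 2)]
    rcases Nat.eq_zero_or_pos (j : ℕ) with h | h
    · simp only [h]
      push_cast [Nat.cast_sub hm]
      norm_num
      ring
    · have h0 : (j : ℕ) ≠ 0 := by omega
      by_cases h1 : (j : ℕ) ≤ n - m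
      · have h2 : 1 ≤ (j : ℕ) ∧ (j : ℕ) + 1 ≤ 2 * (n + 1) - (n + 1 + m) := by omega
        rw [if_neg h0, if_pos h2]
        simp only [h0, h1, if_true, if_false]
        push_cast [Nat.cast_sub h2.1]
        ring
      · have h2 : ¬(1 ≤ (j : ℕ) ∧ (j : ℕ) + 1 ≤ 2 * (n + 1) - (n + 1 + m)) := by omega
        rw [if_neg h0, if_neg h2]
        simp [h0, h1]
end
end

section
/- For every integer l ≥ 1, in the polynomial ring ℤ[q] one has (1 − q^{2l})·Σ_{w ∈ W_{l−1}} q^{ℓ_{l−1}(w)} = (1 − q)·Σ_{w ∈ W_l} q^{ℓ_l(w)}, where for n ≥ 0, W_n denotes the (finite, of order 2^n·n!) Coxeter group attached to the Coxeter matrix of type B_n and ℓ_n its Coxeter length function (for n = 0 the group is trivial and the sum equals 1). -/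
open scoped BigOperators

noncomputable section

/-- The Poincaré polynomial `Σ_{w ∈ W} q^{ℓ(w)}` of the Coxeter group of type `Bₙ`,
where `ℓ` is the Coxeter length function. -/
def poincarePolyB (n : ℕ) [Fintype (CoxeterMatrix.Bₙ n).Group] : Polynomial ℤ :=
  ∑ w : (CoxeterMatrix.Bₙ n).Group,
    Polynomial.X ^ ((CoxeterMatrix.Bₙ n).toCoxeterSystem.length w)

set_option linter.deprecated false

/-- The letters of the word `s₀ s₁ ⋯ s_{n-2} s_{n-1} s_{n-2} ⋯ s₁ s₀`. -/
def cosetLetter (n k : ℕ) : ℕ := if k < n then k else 2 * n - 2 - k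

/-- The product of the first `k` letters of `s₀ s₁ ⋯ s_{n-1} ⋯ s₁ s₀`. For `k < 2n` these are the
minimal representatives of the right cosets of the parabolic subgroup of type `B_{n-1}`. -/
def cosetRep {G : Type*} [Monoid G] (n : ℕ) (s : ℕ → G) : ℕ → G
  | 0 => 1
  | k + 1 => cosetRep n s k * s (cosetLetter n k)

/-- The relations of the Coxeter group of type `B_n`, for a family indexed by `ℕ`
of which only the first `n` terms matter. -/
structure IsTypeB {G : Type*} [Monoid G] (n : ℕ) (s : ℕ → G) : Prop where
  sq : ∀ i < n, s i * s i = 1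
  comm : ∀ i j, i + 1 < j → j < n → s i * s j = s j * s i
  braid : ∀ i, i + 2 < n → s i * s (i + 1) * s i = s (i + 1) * s i * s (i + 1)
  four : ∀ i, i + 2 = n →
    s i * s (i + 1) * s i * s (i + 1) = s (i + 1) * s i * s (i + 1) * s i

namespace IsTypeB

variable {G : Type*} [Monoid G] {n : ℕ} {s : ℕ → G}

theorem cosetRep_succ_of_lt {k : ℕ} (hk : k < n) :
    cosetRep n s (k + 1) = cosetRep n s k * s k := by
  simp [cosetRep, cosetLetter, hk]

theorem cosetRep_add_succ {d m : ℕ} (h : m + d + 2 = n) :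
    cosetRep n s (n + d + 1) = cosetRep n s (n + d) * s m := by
  have : 2 * n - 2 - (n + d) = m := by omega
  simp [cosetRep, cosetLetter, this]

theorem cosetRep_mul_of_lt (H : IsTypeB n s) {k j : ℕ} (hkj : k < j) (hj : j < n) :
    cosetRep n s k * s j = s j * cosetRep n s k := by
  induction k with
  | zero => simp [cosetRep]
  | succ k ih =>
    rw [cosetRep_succ_of_lt (by omega), mul_assoc, H.comm k j hkj hj, ← mul_assoc,
      ih (by omega), mul_assoc]

theorem cosetRep_mul_of_add_two_le (H : IsTypeB n s) {k j : ℕ} (hj : j + 2 < n) (hjk : j + 2 ≤ k)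
    (hk : k ≤ n) : cosetRep n s k * s j = s (j + 1) * cosetRep n s k := by
  induction k, hjk using Nat.le_induction with
  | base =>
    have hrep : cosetRep n s (j + 2) = cosetRep n s j * (s j * s (j + 1)) := by
      rw [cosetRep_succ_of_lt (by omega), cosetRep_succ_of_lt (by omega), mul_assoc]
    rw [hrep, mul_assoc, H.braid j hj, mul_assoc (s (j + 1)), ← mul_assoc,
      H.cosetRep_mul_of_lt (by omega) (by omega), mul_assoc]
  | succ k hjk ih =>
    rw [cosetRep_succ_of_lt (by omega), mul_assoc, ← H.comm j k (by omega) (by omega),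
      ← mul_assoc, ih (by omega), mul_assoc]

theorem cosetRep_add_mul_of_lt (H : IsTypeB n s) {d j : ℕ} (hj : j + d + 2 < n) :
    cosetRep n s (n + d) * s j = s (j + 1) * cosetRep n s (n + d) := by
  induction d with
  | zero => exact H.cosetRep_mul_of_add_two_le hj (by omega) le_rfl
  | succ d ih =>
    obtain ⟨m, hm⟩ : ∃ m, m + d + 2 = n := ⟨n - d - 2, by omega⟩
    rw [← add_assoc, cosetRep_add_succ hm, mul_assoc, ← H.comm j m (by omega) (by omega),
      ← mul_assoc, ih (by omega), mul_assoc]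

theorem cosetRep_add_mul_of_le (H : IsTypeB n s) {d j : ℕ} (hj : j < n) (hjd : n - j ≤ d)
    (hd : d < n) : cosetRep n s (n + d) * s j = s j * cosetRep n s (n + d) := by
  induction d, hjd using Nat.le_induction with
  | base =>
    obtain ⟨i, rfl⟩ : ∃ i, j = i + 1 := ⟨j - 1, by omega⟩
    obtain hn | ⟨d, hn⟩ : i + 2 = n ∨ ∃ d, i + 1 + d + 2 = n := by
      by_cases h : i + 2 = n
      · exact .inl h
      · exact .inr ⟨n - i - 3, by omega⟩
    · have hrep : cosetRep n s (n + 1) = cosetRep n s i * (s i * s (i + 1) * s i) := by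
        have := cosetRep_add_succ (s := s) (d := 0) (m := i) (n := n) (by omega)
        have hi : cosetRep n s n = cosetRep n s i * (s i * s (i + 1)) := by
          rw [← mul_assoc, ← cosetRep_succ_of_lt (by omega), ← cosetRep_succ_of_lt (by omega), ← hn]
        rw [add_zero, hi] at this
        rw [this, mul_assoc]
      rw [show n - (i + 1) = 1 by omega, hrep, mul_assoc, H.four i hn]
      simp only [← mul_assoc]
      rw [H.cosetRep_mul_of_lt (by omega) (by omega)]
    · have hrep : cosetRep n s (n + (d + 2)) = cosetRep n s (n + d) * (s (i + 1) * s i) := by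
        rw [← mul_assoc, ← cosetRep_add_succ (by omega), ← add_assoc]
        exact cosetRep_add_succ (d := d + 1) (by omega)
      rw [show n - (i + 1) = d + 2 by omega, hrep, mul_assoc, ← H.braid i (by omega),
        mul_assoc (s i), ← mul_assoc, H.cosetRep_add_mul_of_lt (by omega), mul_assoc]
  | succ d hjd ih =>
    obtain ⟨m, hm⟩ : ∃ m, m + d + 2 = n := ⟨n - d - 2, by omega⟩
    rw [← add_assoc, cosetRep_add_succ hm, mul_assoc, H.comm m j (by omega) (by omega),
      ← mul_assoc, ih (by omega), mul_assoc]

theorem cosetRep_mul (H : IsTypeB n s) {k j : ℕ} (hk : k < 2 * n) (hj : j < n) :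
    (∃ k' < 2 * n, k' ≤ k + 1 ∧ cosetRep n s k * s j = cosetRep n s k') ∨
      ∃ i, i + 1 < n ∧ cosetRep n s k * s j = s (i + 1) * cosetRep n s k := by
  by_cases hup : k + 1 < 2 * n ∧ cosetLetter n k = j
  · exact .inl ⟨k + 1, hup.1, le_rfl, by rw [cosetRep, hup.2]⟩
  by_cases hdown : ∃ k', k = k' + 1 ∧ cosetLetter n k' = j
  · obtain ⟨k', rfl, rfl⟩ := hdown
    exact .inl ⟨k', by omega, by omega, by rw [cosetRep, mul_assoc, H.sq _ hj, mul_one]⟩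
  right
  have hdown' : k = 0 ∨ cosetLetter n (k - 1) ≠ j := by
    by_contra! h
    exact hdown ⟨k - 1, by omega, h.2⟩
  simp only [cosetLetter] at hup hdown'
  obtain hkj | hkj := lt_or_ge k j
  · obtain ⟨i, rfl⟩ : ∃ i, j = i + 1 := ⟨j - 1, by omega⟩
    exact ⟨i, hj, H.cosetRep_mul_of_lt hkj hj⟩
  obtain hkn | hkn := le_or_gt k n
  · have : j + 2 ≤ k ∧ j + 2 < n := by split_ifs at hup hdown' <;> omega
    exact ⟨j, by omega, H.cosetRep_mul_of_add_two_le this.2 this.1 hkn⟩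
  obtain ⟨d, rfl⟩ : ∃ d, k = n + d := ⟨k - n, by omega⟩
  obtain hjd | hjd := lt_or_ge (j + d + 2) n
  · exact ⟨j, by omega, H.cosetRep_add_mul_of_lt hjd⟩
  · have : n - j ≤ d := by split_ifs at hup hdown' <;> omega
    obtain ⟨i, rfl⟩ : ∃ i, j = i + 1 := ⟨j - 1, by omega⟩
    exact ⟨i, hj, H.cosetRep_add_mul_of_le hj this (by omega)⟩

end IsTypeB

namespace CoxeterMatrix

/-- The simple reflections of the Coxeter group of type `B_n`, extended by `1` to all of `ℕ`. -/
def simpleB (n i : ℕ) : (Bₙ n).Group :=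
  if h : i < n then (Bₙ n).toCoxeterSystem.simple ⟨i, h⟩ else 1

theorem simpleB_of_lt {n i : ℕ} (h : i < n) :
    simpleB n i = (Bₙ n).toCoxeterSystem.simple ⟨i, h⟩ := dif_pos h

theorem simpleB_mul_pow {n i j : ℕ} (hi : i < n) (hj : j < n) :
    (simpleB n i * simpleB n j) ^ (Bₙ n ⟨i, hi⟩ ⟨j, hj⟩) = 1 := by
  rw [simpleB_of_lt hi, simpleB_of_lt hj, CoxeterSystem.simple_mul_simple_pow]

theorem simpleB_mul_self (n i : ℕ) : simpleB n i * simpleB n i = 1 := by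
  unfold simpleB
  split_ifs
  · exact CoxeterSystem.simple_mul_simple_self _ _
  · exact one_mul 1

theorem inv_simpleB (n i : ℕ) : (simpleB n i)⁻¹ = simpleB n i :=
  inv_eq_of_mul_eq_one_right (simpleB_mul_self n i)

theorem Bₙ_apply {n : ℕ} (i j : Fin n) : Bₙ n i j = if i = j then 1 else
    if (i : ℕ) = n - 1 ∧ (j : ℕ) = n - 2 ∨ (j : ℕ) = n - 1 ∧ (i : ℕ) = n - 2 then 4
      else if (j : ℕ) + 1 = i ∨ (i : ℕ) + 1 = j then 3 else 2 := rfl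

theorem isTypeB_simpleB (n : ℕ) : IsTypeB n (simpleB n) where
  sq i _ := simpleB_mul_self n i
  comm i j hij hj := by
    have h := simpleB_mul_pow (i := i) (by omega) hj
    rw [Bₙ_apply, if_neg (by simp; omega), if_neg (by simp; omega), if_neg (by simp; omega),
      pow_two, mul_eq_one_iff_eq_inv, mul_inv_rev, inv_simpleB, inv_simpleB] at h
    exact h
  braid i hi := by
    have h := simpleB_mul_pow (n := n) (i := i) (j := i + 1) (by omega) (by omega)
    rw [Bₙ_apply, if_neg (by simp), if_neg (by simp; omega), if_pos (by simp)] at h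
    have h' : (simpleB n i * simpleB n (i + 1) * simpleB n i) *
        (simpleB n (i + 1) * simpleB n i * simpleB n (i + 1)) = 1 := by
      rw [← h]; simp only [pow_succ, pow_zero, one_mul, mul_assoc]
    rw [mul_eq_one_iff_eq_inv] at h'
    simpa [mul_assoc, inv_simpleB] using h'
  four i hi := by
    have h := simpleB_mul_pow (n := n) (i := i) (j := i + 1) (by omega) (by omega)
    rw [Bₙ_apply, if_neg (by simp), if_pos (by simp; omega)] at h
    have h' : (simpleB n i * simpleB n (i + 1) * simpleB n i * simpleB n (i + 1)) *
        (simpleB n i * simpleB n (i + 1) * simpleB n i * simpleB n (i + 1)) = 1 := by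
      rw [← h]; simp only [pow_succ, pow_zero, one_mul, mul_assoc]
    rw [mul_eq_one_iff_eq_inv] at h'
    simpa [mul_assoc, inv_simpleB] using h'

theorem Bₙ_succ_apply_succ {n : ℕ} (i j : Fin n) : Bₙ (n + 1) i.succ j.succ = Bₙ n i j := by
  have hi := i.isLt
  have hj := j.isLt
  simp only [Bₙ_apply, Fin.val_succ, Fin.ext_iff]
  split_ifs <;> omega

/-- The embedding of the Coxeter group of type `B_n` as the parabolic subgroup of the one of type
`B_{n+1}` that omits the first simple reflection. -/
def parabolicB (n : ℕ) : (Bₙ n).Group →* (Bₙ (n + 1)).Group :=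
  (Bₙ n).toCoxeterSystem.lift ⟨fun i => (Bₙ (n + 1)).toCoxeterSystem.simple i.succ, fun i j => by
    rw [← Bₙ_succ_apply_succ, CoxeterSystem.simple_mul_simple_pow]⟩

theorem parabolicB_simple {n : ℕ} (i : Fin n) :
    parabolicB n ((Bₙ n).toCoxeterSystem.simple i) = (Bₙ (n + 1)).toCoxeterSystem.simple i.succ :=
  CoxeterSystem.lift_apply_simple _ _ i

theorem length_parabolicB_le {n : ℕ} (w : (Bₙ n).Group) :
    (Bₙ (n + 1)).toCoxeterSystem.length (parabolicB n w) ≤ (Bₙ n).toCoxeterSystem.length w := by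
  obtain ⟨ω, hω, rfl⟩ := (Bₙ n).toCoxeterSystem.exists_isReduced w
  have : parabolicB n ((Bₙ n).toCoxeterSystem.wordProd ω) =
      (Bₙ (n + 1)).toCoxeterSystem.wordProd (ω.map Fin.succ) := by
    simp only [CoxeterSystem.wordProd, map_list_prod, List.map_map, Function.comp_def,
      parabolicB_simple]
  rw [this, hω.eq]
  exact ((Bₙ (n + 1)).toCoxeterSystem.length_wordProd_le _).trans_eq (List.length_map _)

theorem length_simpleB_le (n i : ℕ) : (Bₙ n).toCoxeterSystem.length (simpleB n i) ≤ 1 := by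
  unfold simpleB
  split_ifs
  · exact (CoxeterSystem.length_simple _ _).le
  · simp

theorem length_cosetRep_le (n k : ℕ) :
    (Bₙ n).toCoxeterSystem.length (cosetRep n (simpleB n) k) ≤ k := by
  induction k with
  | zero => simp [cosetRep]
  | succ k ih =>
    exact (CoxeterSystem.length_mul_le _ _ _).trans (add_le_add ih (length_simpleB_le _ _))

/-- The factorization map `(w, k) ↦ w x_k`, where `x_k` are the coset representatives. -/
def cosetProd (n : ℕ) (p : (Bₙ n).Group × Fin (2 * (n + 1))) : (Bₙ (n + 1)).Group :=
  parabolicB n p.1 * cosetRep (n + 1) (simpleB (n + 1)) p.2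

theorem length_cosetProd_le {n : ℕ} (p : (Bₙ n).Group × Fin (2 * (n + 1))) :
    (Bₙ (n + 1)).toCoxeterSystem.length (cosetProd n p) ≤
      (Bₙ n).toCoxeterSystem.length p.1 + p.2 :=
  (CoxeterSystem.length_mul_le _ _ _).trans
    (add_le_add (length_parabolicB_le _) (length_cosetRep_le _ _))

theorem exists_cosetProd_eq_mul_simple {n : ℕ} (p : (Bₙ n).Group × Fin (2 * (n + 1)))
    (j : Fin (n + 1)) :
    ∃ p', cosetProd n p' = cosetProd n p * (Bₙ (n + 1)).toCoxeterSystem.simple j ∧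
      (Bₙ n).toCoxeterSystem.length p'.1 + p'.2 ≤ (Bₙ n).toCoxeterSystem.length p.1 + p.2 + 1 := by
  obtain ⟨w, k⟩ := p
  rw [← simpleB_of_lt j.isLt]
  obtain ⟨k', hk', hle, h⟩ | ⟨i, hi, h⟩ :=
    (isTypeB_simpleB (n + 1)).cosetRep_mul k.isLt j.isLt
  · refine ⟨(w, ⟨k', hk'⟩), ?_, ?_⟩
    · simp only [cosetProd, mul_assoc, h]
    · simp only; omega
  · refine ⟨(w * (Bₙ n).toCoxeterSystem.simple ⟨i, by omega⟩, k), ?_, ?_⟩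
    · simp only [cosetProd, mul_assoc, h, map_mul, parabolicB_simple, simpleB_of_lt hi,
        Fin.succ_mk]
    · have := (Bₙ n).toCoxeterSystem.length_mul_le w
        ((Bₙ n).toCoxeterSystem.simple ⟨i, by omega⟩)
      rw [CoxeterSystem.length_simple] at this
      simp only; omega

theorem exists_cosetProd_eq_wordProd {n : ℕ} (ω : List (Fin (n + 1))) :
    ∃ p, cosetProd n p = (Bₙ (n + 1)).toCoxeterSystem.wordProd ω ∧
      (Bₙ n).toCoxeterSystem.length p.1 + p.2 ≤ ω.length := by
  induction ω using List.reverseRecOn with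
  | nil => exact ⟨(1, 0), by simp [cosetProd, cosetRep], by simp⟩
  | append_singleton ω j ih =>
    obtain ⟨p, hp, hle⟩ := ih
    obtain ⟨p', hp', hle'⟩ := exists_cosetProd_eq_mul_simple p j
    refine ⟨p', ?_, ?_⟩
    · rw [hp', hp, CoxeterSystem.wordProd_append, CoxeterSystem.wordProd_singleton]
    · rw [List.length_append, List.length_singleton]; omega

theorem exists_cosetProd_eq {n : ℕ} (g : (Bₙ (n + 1)).Group) :
    ∃ p, cosetProd n p = g ∧ (Bₙ n).toCoxeterSystem.length p.1 + p.2 ≤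
      (Bₙ (n + 1)).toCoxeterSystem.length g := by
  obtain ⟨ω, hω, rfl⟩ := (Bₙ (n + 1)).toCoxeterSystem.exists_isReduced g
  rw [hω.eq]
  exact exists_cosetProd_eq_wordProd ω

theorem cosetProd_bijective {n : ℕ} [Fintype (Bₙ n).Group] [Fintype (Bₙ (n + 1)).Group]
    (h : Fintype.card (Bₙ (n + 1)).Group = 2 * (n + 1) * Fintype.card (Bₙ n).Group) :
    Function.Bijective (cosetProd n) := by
  rw [Fintype.bijective_iff_surjective_and_card]
  refine ⟨fun g => (exists_cosetProd_eq g).imp fun _ hp => hp.1, ?_⟩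
  rw [Fintype.card_prod, Fintype.card_fin, h, mul_comm]

theorem length_cosetProd {n : ℕ} (h : Function.Injective (cosetProd n))
    (p : (Bₙ n).Group × Fin (2 * (n + 1))) :
    (Bₙ (n + 1)).toCoxeterSystem.length (cosetProd n p) =
      (Bₙ n).toCoxeterSystem.length p.1 + p.2 := by
  obtain ⟨p', hp', hle⟩ := exists_cosetProd_eq (cosetProd n p)
  rw [h hp'] at hle
  exact le_antisymm (length_cosetProd_le p) hle

end CoxeterMatrix

theorem poincarePolyB_succ {n : ℕ} [Fintype (CoxeterMatrix.Bₙ n).Group]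
    [Fintype (CoxeterMatrix.Bₙ (n + 1)).Group]
    (h : Fintype.card (CoxeterMatrix.Bₙ (n + 1)).Group =
      2 * (n + 1) * Fintype.card (CoxeterMatrix.Bₙ n).Group) :
    poincarePolyB (n + 1) =
      poincarePolyB n * ∑ k ∈ Finset.range (2 * (n + 1)), (Polynomial.X : Polynomial ℤ) ^ k := by
  have hbij := CoxeterMatrix.cosetProd_bijective h
  rw [poincarePolyB, ← hbij.sum_comp, Fintype.sum_prod_type, poincarePolyB, Finset.sum_mul]
  refine Finset.sum_congr rfl fun w _ => ?_
  rw [← Fin.sum_univ_eq_sum_range, Finset.mul_sum]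
  refine Finset.sum_congr rfl fun k _ => ?_
  rw [CoxeterMatrix.length_cosetProd hbij.injective, pow_add]

/-- For every `l ≥ 1`, in `ℤ[q]` one has
`(1 − q^{2l})·Σ_{w ∈ W_{l−1}} q^{ℓ(w)} = (1 − q)·Σ_{w ∈ W_l} q^{ℓ(w)}`,
where `W_n` is the Coxeter group of type `Bₙ` (finite of order `2^n·n!`,
taken as a hypothesis) and `ℓ` its length function. -/
theorem stmt_4 (l : ℕ) (hl : 1 ≤ l)
    [Fintype (CoxeterMatrix.Bₙ (l - 1)).Group] [Fintype (CoxeterMatrix.Bₙ l).Group]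
    (hcard₁ : Fintype.card (CoxeterMatrix.Bₙ (l - 1)).Group =
      2 ^ (l - 1) * Nat.factorial (l - 1))
    (hcard₂ : Fintype.card (CoxeterMatrix.Bₙ l).Group = 2 ^ l * Nat.factorial l) :
    (1 - (Polynomial.X : Polynomial ℤ) ^ (2 * l)) * poincarePolyB (l - 1) =
      (1 - (Polynomial.X : Polynomial ℤ)) * poincarePolyB l := by
  rename_i inst _
  obtain ⟨n, rfl⟩ : ∃ n, l = n + 1 := ⟨l - 1, by omega⟩
  let : Fintype (CoxeterMatrix.Bₙ n).Group := inst
  change Fintype.card (CoxeterMatrix.Bₙ n).Group = 2 ^ n * n.factorial at hcard₁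
  change _ * poincarePolyB n = _
  have h : Fintype.card (CoxeterMatrix.Bₙ (n + 1)).Group =
      2 * (n + 1) * Fintype.card (CoxeterMatrix.Bₙ n).Group := by
    rw [hcard₁, hcard₂, Nat.factorial_succ]
    ring
  rw [poincarePolyB_succ h, ← mul_neg_geom_sum]
  ring
end
end
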